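/- arXiv:2011.02960 — 2 statements merged into one kernel-verified Lean document; each statement's English description precedes it below -/
import Mathlib

section
/- (Sharpness of the q-Ostrowski inequality on the q-lattice) Let 0<q<1 and m∈ℕ∪{0}, and define f:[0,1]→ℝ by f(t) = |t − q^m|. Then f is q-integrable over [0,1], sup_{t∈(0,1]} |D_q f(t)| = 1, and |f(q^m) − ∫_0^1 f(t) d_q t| = ((1 + 2q^{2m+1})/(1+q) − q^m) · sup_{t∈(0,1]} |D_q f(t)|. -/
open Set

/-- Shifted q-derivative of `f` (with base point `a`). -/
noncomputable def qDeriv (q a : ℝ) (f : ℝ → ℝ) (x : ℝ) : ℝ :=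
  (f x - f (a + q * (x - a))) / ((1 - q) * (x - a))

/-- Shifted q-integral of `f` over `[a,b]`. -/
noncomputable def qIntegral (q a b : ℝ) (f : ℝ → ℝ) : ℝ :=
  (1 - q) * (b - a) * ∑' k : ℕ, q ^ k * f (a + q ^ k * (b - a))

/-- `f` is q-integrable over `[a,b]`. -/
def qIntegrable (q a b : ℝ) (f : ℝ → ℝ) : Prop :=
  Summable fun k : ℕ => q ^ k * f (a + q ^ k * (b - a))

theorem sum_range_pow_mul_pow_sub (q c : ℝ) (hq : 0 < q) (hq1 : q < 1) (m : ℕ) :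
    ∑ k ∈ Finset.range m, q ^ k * (q ^ k - c) =
      (1 - q ^ (2 * m)) / (1 - q ^ 2) - c * ((1 - q ^ m) / (1 - q)) := by
  have h1 : 1 - q ≠ 0 := by linarith
  have h2 : 1 - q ^ 2 ≠ 0 := by nlinarith
  induction m with
  | zero => simp
  | succ n ih =>
    rw [Finset.sum_range_succ, ih]
    field_simp
    ring

theorem hasSum_pow_mul_abs_pow_sub (q : ℝ) (hq : 0 < q) (hq1 : q < 1) (m : ℕ) :
    HasSum (fun k : ℕ => q ^ k * |q ^ k - q ^ m|)
      (((1 + 2 * q ^ (2 * m + 1)) / (1 + q) - q ^ m) / (1 - q)) := by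
  have h1 : 1 - q ≠ 0 := by linarith
  have h2 : 1 - q ^ 2 ≠ 0 := by nlinarith
  have h3 : 1 + q ≠ 0 := by linarith
  have hgeom := (hasSum_geometric_of_lt_one hq.le hq1).mul_left (q ^ m)
  have hgeom_sq := hasSum_geometric_of_lt_one (sq_nonneg q) (by nlinarith : q ^ 2 < 1)
  have hfin : HasSum (fun k : ℕ => if k ∈ Finset.range m then q ^ k * (q ^ k - q ^ m) else 0)
      (∑ k ∈ Finset.range m, q ^ k * (q ^ k - q ^ m)) := by
    have h := hasSum_sum_of_ne_finset_zero (s := Finset.range m)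
      (f := fun k : ℕ => if k ∈ Finset.range m then q ^ k * (q ^ k - q ^ m) else 0)
      (L := SummationFilter.unconditional ℕ) (fun b hb => if_neg hb)
    rwa [Finset.sum_congr rfl fun k hk => if_pos hk] at h
  rw [sum_range_pow_mul_pow_sub q _ hq hq1] at hfin
  convert (hgeom.sub hgeom_sq).add (hfin.mul_left 2) using 1
  · rfl
  · funext k
    by_cases hk : k < m
    · have hle : q ^ m ≤ q ^ k := pow_le_pow_of_le_one hq.le hq1.le hk.le
      rw [abs_of_nonneg (sub_nonneg.2 hle), if_pos (Finset.mem_range.2 hk)]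
      ring
    · have hle : q ^ k ≤ q ^ m := pow_le_pow_of_le_one hq.le hq1.le (not_lt.1 hk)
      rw [abs_of_nonpos (sub_nonpos.2 hle), if_neg (by simpa using hk)]
      ring
  · have h4 : 1 - q ^ 2 = (1 - q) * (1 + q) := by ring
    rw [h4]
    field_simp
    ring

theorem abs_qDeriv_abs_sub_le_one (q : ℝ) (hq1 : q < 1) (c t : ℝ) (ht : 0 < t) :
    |qDeriv q 0 (fun t => |t - c|) t| ≤ 1 := by
  have hpos : 0 < (1 - q) * t := mul_pos (by linarith) ht
  simp only [qDeriv, sub_zero, zero_add]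
  rw [abs_div, abs_of_pos hpos, div_le_one hpos]
  calc |(|t - c| - |q * t - c|)| ≤ |(t - c) - (q * t - c)| := abs_abs_sub_abs_le _ _
    _ = (1 - q) * t := by
      rw [← abs_of_pos hpos]
      ring_nf

theorem abs_qDeriv_abs_sub_self (q : ℝ) (hq1 : q < 1) (c : ℝ) (hc : 0 < c) :
    |qDeriv q 0 (fun t => |t - c|) c| = 1 := by
  have hpos : 0 < (1 - q) * c := mul_pos (by linarith) hc
  have hle : q * c - c ≤ 0 := by linarith
  have hne : (1 - q) * c ≠ 0 := hpos.ne'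
  simp only [qDeriv, sub_zero, zero_add, sub_self, abs_zero]
  rw [abs_of_nonpos hle, abs_div, abs_of_pos hpos, zero_sub, neg_neg, abs_of_nonpos hle,
    div_eq_one_iff_eq hne]
  ring

theorem isGreatest_abs_qDeriv_abs_sub (q : ℝ) (hq1 : q < 1) (c : ℝ) (hc : c ∈ Ioc (0 : ℝ) 1) :
    IsGreatest ((fun t => |qDeriv q 0 (fun t => |t - c|) t|) '' Ioc 0 1) 1 := by
  refine ⟨⟨c, hc, abs_qDeriv_abs_sub_self q hq1 c hc.1⟩, ?_⟩
  rintro _ ⟨t, ht, rfl⟩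
  exact abs_qDeriv_abs_sub_le_one q hq1 c t ht.1

/-- sharpness of the q-Ostrowski inequality on the q-lattice. -/
theorem stmt_6 (q : ℝ) (hq : 0 < q) (hq1 : q < 1) (m : ℕ)
    (f : ℝ → ℝ) (hf : f = fun t => |t - q ^ m|) :
    qIntegrable q 0 1 f ∧
    sSup ((fun t => |qDeriv q 0 f t|) '' Set.Ioc 0 1) = 1 ∧
    |f (q ^ m) - qIntegral q 0 1 f| =
      ((1 + 2 * q ^ (2 * m + 1)) / (1 + q) - q ^ m) *
        sSup ((fun t => |qDeriv q 0 f t|) '' Set.Ioc 0 1) := by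
  subst hf
  have hsum := hasSum_pow_mul_abs_pow_sub q hq hq1 m
  have hsup := (isGreatest_abs_qDeriv_abs_sub q hq1 (q ^ m)
    ⟨pow_pos hq m, pow_le_one₀ hq.le hq1.le⟩).csSup_eq
  refine ⟨by simpa [qIntegrable] using hsum.summable, hsup, ?_⟩
  have h1 : 1 - q ≠ 0 := by linarith
  have hnonneg := mul_nonneg (by linarith : 0 ≤ 1 - q)
    (hsum.nonneg fun k => mul_nonneg (pow_nonneg hq.le k) (abs_nonneg _))
  rw [mul_div_cancel₀ _ h1] at hnonneg
  rw [hsup, mul_one]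
  simp only [qIntegral, sub_zero, zero_add, mul_one, sub_self, abs_zero]
  rw [hsum.tsum_eq, mul_div_cancel₀ _ h1, zero_sub, abs_neg, abs_of_nonneg hnonneg]
end

section
/- Let 0<q<1, a<b be real numbers, and f:[a,b]→ℝ a q-integrable function over [a,b] that is continuous at x=a. Then |f(a) − (1/(b−a))·∫_a^b f(t) d_q^a t| ≤ ((b−a)/(1+q))·‖D_q^a f‖_∞^{(a,b]}. -/
open Set

open Filter Topology

/-- If the q-derivative is bounded by `M` and `f` is continuous at `a`, then `f` deviates from `f a`
by at most `M` times the distance to `a` along the nodes of the q-integral. -/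
theorem abs_sub_le_of_abs_qDeriv_le {q a b M : ℝ} {f : ℝ → ℝ} (hq : 0 < q) (hq1 : q < 1)
    (hab : a < b) (hcont : ContinuousWithinAt f (Set.Icc a b) a)
    (hM : ∀ t ∈ Set.Ioc a b, |qDeriv q a f t| ≤ M) (n : ℕ) :
    |f a - f (a + q ^ n * (b - a))| ≤ M * (b - a) * q ^ n := by
  have hba : 0 < b - a := sub_pos.2 hab
  have h1q : 0 < 1 - q := sub_pos.2 hq1
  have hstep : ∀ k : ℕ, dist (f (a + q ^ k * (b - a))) (f (a + q ^ (k + 1) * (b - a))) ≤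
      M * (1 - q) * (b - a) * q ^ k := by
    intro k
    have hqk : 0 < q ^ k := pow_pos hq k
    have hqk1 : q ^ k ≤ 1 := pow_le_one₀ hq.le hq1.le
    have h := hM (a + q ^ k * (b - a)) ⟨by nlinarith, by nlinarith⟩
    have he : a + q * (a + q ^ k * (b - a) - a) = a + q ^ (k + 1) * (b - a) := by ring
    have hd : 0 < (1 - q) * (a + q ^ k * (b - a) - a) := by
      rw [add_sub_cancel_left]; positivity
    rw [qDeriv, he, abs_div, abs_of_pos hd, div_le_iff₀ hd] at h
    rw [Real.dist_eq]
    linarith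
  have hnodes : Tendsto (fun k : ℕ => a + q ^ k * (b - a)) atTop (𝓝[Set.Icc a b] a) := by
    refine tendsto_nhdsWithin_iff.2 ⟨?_, Eventually.of_forall fun k => ?_⟩
    · simpa using ((tendsto_pow_atTop_nhds_zero_of_lt_one hq.le hq1).mul_const (b - a)).const_add a
    · have hqk : 0 < q ^ k := pow_pos hq k
      have hqk1 : q ^ k ≤ 1 := pow_le_one₀ hq.le hq1.le
      exact ⟨by nlinarith, by nlinarith⟩
  have h := dist_le_of_le_geometric_of_tendsto q _ hq1 hstep (hcont.tendsto.comp hnodes) n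
  rw [dist_comm, Real.dist_eq] at h
  refine h.trans_eq ?_
  field_simp

/-- q-Ostrowski inequality at the left endpoint. -/
theorem stmt_9 (q a b : ℝ) (hq : 0 < q) (hq1 : q < 1) (hab : a < b)
    (f : ℝ → ℝ) (hf : qIntegrable q a b f)
    (hcont : ContinuousWithinAt f (Set.Icc a b) a)
    (M : ℝ) (hM : ∀ t ∈ Set.Ioc a b, |qDeriv q a f t| ≤ M) :
    |f a - (1 / (b - a)) * qIntegral q a b f| ≤ ((b - a) / (1 + q)) * M := by
  have hba : 0 < b - a := sub_pos.2 hab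
  have h1q : 0 < 1 - q := sub_pos.2 hq1
  have hq2 : q ^ 2 < 1 := by nlinarith
  have hgeom : HasSum (fun k : ℕ => q ^ k * f a) ((1 - q)⁻¹ * f a) :=
    (hasSum_geometric_of_lt_one hq.le hq1).mul_right (f a)
  have hdiff := hgeom.sub hf.hasSum
  have hbound : HasSum (fun k : ℕ => M * (b - a) * (q ^ 2) ^ k) (M * (b - a) * (1 - q ^ 2)⁻¹) :=
    (hasSum_geometric_of_lt_one (sq_nonneg q) hq2).mul_left _
  have hle : |(1 - q)⁻¹ * f a - ∑' k : ℕ, q ^ k * f (a + q ^ k * (b - a))| ≤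
      M * (b - a) * (1 - q ^ 2)⁻¹ := by
    rw [← hdiff.tsum_eq, ← Real.norm_eq_abs]
    refine tsum_of_norm_bounded hbound fun k => ?_
    rw [← mul_sub, Real.norm_eq_abs, abs_mul, abs_of_pos (pow_pos hq k)]
    calc q ^ k * |f a - f (a + q ^ k * (b - a))|
        ≤ q ^ k * (M * (b - a) * q ^ k) := by
          gcongr
          exact abs_sub_le_of_abs_qDeriv_le hq hq1 hab hcont hM k
      _ = M * (b - a) * (q ^ 2) ^ k := by ring
  have heq : f a - (1 / (b - a)) * qIntegral q a b f =
      (1 - q) * ((1 - q)⁻¹ * f a - ∑' k : ℕ, q ^ k * f (a + q ^ k * (b - a))) := by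
    rw [qIntegral]
    field_simp
  rw [heq, abs_mul, abs_of_pos h1q]
  refine (mul_le_mul_of_nonneg_left hle h1q.le).trans_eq ?_
  have hfac : 1 - q ^ 2 = (1 - q) * (1 + q) := by ring
  rw [hfac]
  field_simp
end
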